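/- Let F : Ω → ℝ^{n+k} be a translating soliton with respect to the unit vector W. Then the function S(x) = ⟨F(x), W⟩ has no local minimum in Ω; i.e., there is no x₀ ∈ Ω and no neighborhood U ⊆ Ω of x₀ with S(x₀) ≤ S(x) for all x ∈ U. -/

import Mathlib

open Real MeasureTheory

noncomputable section

/-- Partial derivative of a scalar function in the `i`-th coordinate direction. -/
def pd {n : ℕ} (i : Fin n) (φ : (Fin n → ℝ) → ℝ) (x : Fin n → ℝ) : ℝ :=
  fderiv ℝ φ x (Pi.single i 1)

/-- Induced metric `g_{ij} = ⟨∂_i F, ∂_j F⟩`. -/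
def gmat {n m : ℕ} (F : (Fin n → ℝ) → (Fin m → ℝ)) (x : Fin n → ℝ) :
    Matrix (Fin n) (Fin n) ℝ :=
  Matrix.of fun i j => ∑ a, pd i (fun y => F y a) x * pd j (fun y => F y a) x

/-- Inverse metric `g^{ij}`. -/
def ginv {n m : ℕ} (F : (Fin n → ℝ) → (Fin m → ℝ)) (x : Fin n → ℝ) :
    Matrix (Fin n) (Fin n) ℝ :=
  (gmat F x)⁻¹

/-- Laplace–Beltrami operator `Δ_g φ = g^{-1/2} Σ_{i,j} ∂_i (g^{1/2} g^{ij} ∂_j φ)`. -/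
def lapB {n m : ℕ} (F : (Fin n → ℝ) → (Fin m → ℝ)) (φ : (Fin n → ℝ) → ℝ)
    (x : Fin n → ℝ) : ℝ :=
  (Real.sqrt (gmat F x).det)⁻¹ *
    ∑ i, ∑ j, pd i (fun y => Real.sqrt (gmat F y).det * ginv F y i j * pd j φ y) x

/-- Mean curvature vector `H̄ = Δ_g F` (componentwise). -/
def Hvec {n m : ℕ} (F : (Fin n → ℝ) → (Fin m → ℝ)) (x : Fin n → ℝ) : Fin m → ℝ :=
  fun a => lapB F (fun y => F y a) x

/-- Tangential projection of an ambient vector `V` onto `span{∂_1 F(x), …, ∂_n F(x)}`: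
`V^⊤ = Σ_{i,j} g^{ij} ⟨V, ∂_j F⟩ ∂_i F`. -/
def tproj {n m : ℕ} (F : (Fin n → ℝ) → (Fin m → ℝ)) (x : Fin n → ℝ)
    (V : Fin m → ℝ) : Fin m → ℝ :=
  fun a => ∑ i, ∑ j, ginv F x i j * (∑ b, V b * pd j (fun y => F y b) x)
      * pd i (fun y => F y a) x

/-- `S(x) = ⟨F(x), W⟩`. -/
def Sfun {n m : ℕ} (F : (Fin n → ℝ) → (Fin m → ℝ)) (W : Fin m → ℝ)
    (x : Fin n → ℝ) : ℝ :=
  ∑ a, F x a * W a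

theorem fderiv_eq_sum_pd {n : ℕ} (φ : (Fin n → ℝ) → ℝ) (x v : Fin n → ℝ) :
    fderiv ℝ φ x v = ∑ j, v j * pd j φ x := by
  conv_lhs => rw [← Finset.univ_sum_single v]
  rw [map_sum]
  refine Finset.sum_congr rfl fun j _ => ?_
  have : Pi.single j (v j) = v j • (Pi.single j 1 : Fin n → ℝ) := by
    rw [← Pi.single_smul, smul_eq_mul, mul_one]
  rw [this, map_smul, smul_eq_mul, pd]

theorem ContDiffAt.pd {n : ℕ} {φ : (Fin n → ℝ) → ℝ} {x : Fin n → ℝ} {r s : WithTop ℕ∞}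
    (h : ContDiffAt ℝ r φ x) (hs : s + 1 ≤ r) (i : Fin n) :
    ContDiffAt ℝ s (pd i φ) x :=
  (h.fderiv_right hs).clm_apply contDiffAt_const

/-- At a local minimum where the first derivative is differentiable, the second derivative is
nonnegative. -/
theorem IsLocalMin.deriv_deriv_nonneg {f : ℝ → ℝ} {a : ℝ} (h : IsLocalMin f a)
    (hc : ContinuousAt f a) : 0 ≤ deriv (deriv f) a := by
  by_contra! hneg
  have hmax := isLocalMax_of_deriv_deriv_neg hneg h.deriv_eq_zero hc
  have hconst : f =ᶠ[nhds a] fun _ => f a := by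
    filter_upwards [h, hmax] with y h₁ h₂ using le_antisymm h₂ h₁
  rw [hconst.deriv.deriv_eq] at hneg
  simp at hneg

theorem IsLocalMin.hessian_nonneg {n : ℕ} {φ : (Fin n → ℝ) → ℝ} {x : Fin n → ℝ}
    (h : IsLocalMin φ x) (hφ : ContDiffAt ℝ 2 φ x) (v : Fin n → ℝ) :
    0 ≤ ∑ i, ∑ j, v i * v j * pd i (pd j φ) x := by
  set ℓ : ℝ → Fin n → ℝ := fun t => x + t • v
  have hℓ0 : ℓ 0 = x := by simp [ℓ]
  have hℓ (t : ℝ) : HasDerivAt ℓ v t := by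
    simpa only [id, one_smul] using ((hasDerivAt_id t).smul_const v).const_add x
  have hℓc : Filter.Tendsto ℓ (nhds 0) (nhds x) := by
    simpa [hℓ0] using (hℓ 0).continuousAt.tendsto
  have hmin : IsLocalMin (φ ∘ ℓ) 0 := by
    filter_upwards [hℓc.eventually h] with t ht
    simpa [hℓ0] using ht
  have hcont : ContinuousAt (φ ∘ ℓ) 0 :=
    ContinuousAt.comp (by simpa [hℓ0] using hφ.continuousAt) (hℓ 0).continuousAt
  have hd : deriv (φ ∘ ℓ) =ᶠ[nhds 0] fun t => ∑ j, v j * pd j φ (ℓ t) := by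
    filter_upwards [hℓc.eventually (hφ.eventually (by simp))] with t ht
    rw [← fderiv_eq_sum_pd]
    exact ((ht.differentiableAt (by simp)).hasFDerivAt.comp_hasDerivAt t (hℓ t)).deriv
  have hdd : HasDerivAt (fun t => ∑ j, v j * pd j φ (ℓ t))
      (∑ j, v j * ∑ i, v i * pd i (pd j φ) x) 0 := by
    refine HasDerivAt.fun_sum fun j _ => HasDerivAt.const_mul _ ?_
    rw [← fderiv_eq_sum_pd]
    have hj : HasFDerivAt (pd j φ) (fderiv ℝ (pd j φ) x) (ℓ 0) := by
      rw [hℓ0]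
      exact ((hφ.pd (s := 1) (by norm_num) j).differentiableAt (by simp)).hasFDerivAt
    exact hj.comp_hasDerivAt 0 (hℓ 0)
  have key := hmin.deriv_deriv_nonneg hcont
  rw [hd.deriv_eq, hdd.deriv] at key
  refine key.trans_eq ?_
  simp only [Finset.mul_sum]
  rw [Finset.sum_comm]
  exact Finset.sum_congr rfl fun i _ => Finset.sum_congr rfl fun j _ => by ring

theorem Matrix.PosSemidef.sum_mul_nonneg {n : ℕ} {A : Matrix (Fin n) (Fin n) ℝ}
    (hA : A.PosSemidef) {h : Fin n → Fin n → ℝ}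
    (hh : ∀ v : Fin n → ℝ, 0 ≤ ∑ i, ∑ j, v i * v j * h i j) :
    0 ≤ ∑ i, ∑ j, A i j * h i j := by
  obtain ⟨m, v, rfl⟩ := Matrix.posSemidef_iff_eq_sum_vecMulVec.mp hA
  have : ∑ i, ∑ j, (∑ a, Matrix.vecMulVec (v a) (star (v a))) i j * h i j
      = ∑ a, ∑ i, ∑ j, v a i * v a j * h i j := by
    simp only [Matrix.sum_apply, Matrix.vecMulVec_apply, star_trivial,
      Finset.sum_mul]
    rw [Finset.sum_comm]
    refine (Finset.sum_congr rfl fun i _ => Finset.sum_comm).trans ?_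
    rw [Finset.sum_comm]
    exact Finset.sum_congr rfl fun a _ => Finset.sum_comm
  rw [this]
  exact Finset.sum_nonneg fun a _ => hh (v a)

theorem DifferentiableAt.matrix_det {E : Type*} [NormedAddCommGroup E] [NormedSpace ℝ E] {n : ℕ}
    {A : E → Matrix (Fin n) (Fin n) ℝ} {x : E}
    (h : ∀ i j, DifferentiableAt ℝ (fun y => A y i j) x) :
    DifferentiableAt ℝ (fun y => (A y).det) x := by
  simp only [Matrix.det_apply']
  exact DifferentiableAt.fun_sum fun σ _ =>
    (HasFDerivAt.finsetProd fun i _ => (h (σ i) i).hasFDerivAt).differentiableAt.const_mul _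

theorem DifferentiableAt.matrix_inv {E : Type*} [NormedAddCommGroup E] [NormedSpace ℝ E] {n : ℕ}
    {A : E → Matrix (Fin n) (Fin n) ℝ} {x : E}
    (h : ∀ i j, DifferentiableAt ℝ (fun y => A y i j) x) (hx : (A x).det ≠ 0) (i j : Fin n) :
    DifferentiableAt ℝ (fun y => (A y)⁻¹ i j) x := by
  simp only [Matrix.inv_def, Ring.inverse_eq_inv', Matrix.smul_apply, smul_eq_mul,
    Matrix.adjugate_apply]
  refine ((DifferentiableAt.matrix_det h).inv hx).mul (DifferentiableAt.matrix_det fun k l => ?_)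
  by_cases hk : k = j
  · subst hk
    simp
  · simpa [Matrix.updateRow_ne hk] using h k l

theorem pd_mul {n : ℕ} {c φ : (Fin n → ℝ) → ℝ} {x : Fin n → ℝ} (i : Fin n)
    (hc : DifferentiableAt ℝ c x) (hφ : DifferentiableAt ℝ φ x) :
    pd i (fun y => c y * φ y) x = c x * pd i φ x + pd i c x * φ x := by
  simp only [pd, fderiv_fun_mul hc hφ]
  simp [mul_comm]

theorem pd_sum_mul {n m : ℕ} {F : (Fin n → ℝ) → Fin m → ℝ} {x : Fin n → ℝ} (i : Fin n)
    (hF : ∀ a, DifferentiableAt ℝ (fun y => F y a) x) (W : Fin m → ℝ) :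
    pd i (fun y => ∑ a, F y a * W a) x = ∑ a, pd i (fun y => F y a) x * W a := by
  rw [pd, fderiv_fun_sum fun a _ => (hF a).mul_const _]
  simp [pd, fderiv_mul_const (hF _), mul_comm]

/-- At a critical point of `⟨F, W⟩` the Laplace–Beltrami operator only sees the Hessian. -/
theorem sum_Hvec_mul_of_critical {n m : ℕ} {F : (Fin n → ℝ) → Fin m → ℝ} {x : Fin n → ℝ}
    (hF : ∀ a, ContDiffAt ℝ 2 (fun y => F y a) x) (hg : (gmat F x).PosDef) (W : Fin m → ℝ)
    (hcrit : ∀ j, pd j (Sfun F W) x = 0) :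
    ∑ a, Hvec F x a * W a = ∑ i, ∑ j, ginv F x i j * pd i (pd j (Sfun F W)) x := by
  have hdF (a) : DifferentiableAt ℝ (fun y => F y a) x := (hF a).differentiableAt (by simp)
  have hdpd (j a) : DifferentiableAt ℝ (pd j (fun y => F y a)) x :=
    ((hF a).pd (s := 1) (by norm_num) j).differentiableAt (by simp)
  have hdg (i j) : DifferentiableAt ℝ (fun y => gmat F y i j) x := by
    simp only [gmat, Matrix.of_apply]
    exact DifferentiableAt.fun_sum fun a _ => (hdpd i a).mul (hdpd j a)
  have hdet := hg.det_pos
  have hc (i j) : DifferentiableAt ℝ (fun y => √(gmat F y).det * ginv F y i j) x :=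
    ((DifferentiableAt.matrix_det hdg).sqrt hdet.ne').mul
      (DifferentiableAt.matrix_inv hdg hdet.ne' i j)
  have hSx (j) : ∑ a, pd j (fun y => F y a) x * W a = 0 := by
    rw [← pd_sum_mul j hdF W]
    exact hcrit j
  have hSS (i j) : pd i (pd j (Sfun F W)) x
      = ∑ a, pd i (pd j (fun y => F y a)) x * W a := by
    have hev : pd j (Sfun F W) =ᶠ[nhds x] fun y => ∑ a, pd j (fun z => F z a) y * W a := by
      filter_upwards [Filter.eventually_all.mpr fun a => (hF a).eventually (by simp)] with y hy
      exact pd_sum_mul j (fun a => (hy a).differentiableAt (by simp)) W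
    rw [pd, hev.fderiv_eq]
    exact pd_sum_mul (F := fun y a => pd j (fun z => F z a) y) i (hdpd j) W
  have hs : √(gmat F x).det ≠ 0 := (Real.sqrt_pos.mpr hdet).ne'
  have hterm (i j) : ∑ a, (√(gmat F x).det)⁻¹ *
        pd i (fun y => √(gmat F y).det * ginv F y i j * pd j (fun z => F z a) y) x * W a
      = ginv F x i j * pd i (pd j (Sfun F W)) x := by
    have h₁ (a) : (√(gmat F x).det)⁻¹ *
        pd i (fun y => √(gmat F y).det * ginv F y i j * pd j (fun z => F z a) y) x * W a
        = ginv F x i j * (pd i (pd j (fun z => F z a)) x * W a)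
          + (√(gmat F x).det)⁻¹ * pd i (fun y => √(gmat F y).det * ginv F y i j) x
            * (pd j (fun z => F z a) x * W a) := by
      rw [pd_mul i (hc i j) (hdpd j a)]
      field_simp
    simp only [h₁, Finset.sum_add_distrib, ← Finset.mul_sum, hSx, hSS, mul_zero, add_zero]
  simp only [← hterm, Hvec, lapB, Finset.mul_sum, Finset.sum_mul]
  rw [Finset.sum_comm]
  exact Finset.sum_congr rfl fun i _ => Finset.sum_comm

/-- If `F : Ω → ℝ^{n+k}` is a translating soliton with respect to the
unit vector `W`, then `S(x) = ⟨F(x), W⟩` has no local minimum in `Ω`. -/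
theorem soliton_no_local_min {n k : ℕ} (hn : 1 ≤ n) (hk : 1 ≤ k)
    (Ω : Set (Fin n → ℝ)) (hΩo : IsOpen Ω) (hΩne : Ω.Nonempty)
    (F : (Fin n → ℝ) → (Fin (n + k) → ℝ)) (hF : ContDiffOn ℝ (⊤ : ℕ∞) F Ω)
    (himm : ∀ x ∈ Ω, (gmat F x).PosDef)
    (W : Fin (n + k) → ℝ) (hW : ∑ a, (W a) ^ 2 = 1)
    (hsol : ∀ x ∈ Ω, ∀ a, Hvec F x a = -(W a - tproj F x W a)) :
    ¬ ∃ x₀ ∈ Ω, ∃ U : Set (Fin n → ℝ), U ⊆ Ω ∧ U ∈ nhds x₀ ∧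
        ∀ x ∈ U, Sfun F W x₀ ≤ Sfun F W x := by
  rintro ⟨x₀, hx₀, U, -, hU, hmin⟩
  have hloc : IsLocalMin (Sfun F W) x₀ := Filter.mem_of_superset hU hmin
  have hFa (a) : ContDiffAt ℝ 2 (fun y => F y a) x₀ :=
    contDiffAt_pi.mp ((hF.contDiffAt (hΩo.mem_nhds hx₀)).of_le (WithTop.coe_le_coe.mpr le_top)) a
  have hS : ContDiffAt ℝ 2 (Sfun F W) x₀ :=
    ContDiffAt.sum fun a _ => (hFa a).mul contDiffAt_const
  have hcrit (j) : pd j (Sfun F W) x₀ = 0 := by simp [pd, hloc.fderiv_eq_zero]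
  have htproj (a) : tproj F x₀ W a = 0 := by
    have hj (j) : ∑ b, W b * pd j (fun y => F y b) x₀ = 0 := by
      simp_rw [mul_comm (W _)]
      rw [← pd_sum_mul j (fun a => (hFa a).differentiableAt (by simp)) W]
      exact hcrit j
    simp [tproj, hj]
  have hneg : ∑ a, Hvec F x₀ a * W a = -1 := by
    rw [← hW, ← Finset.sum_neg_distrib]
    refine Finset.sum_congr rfl fun a _ => ?_
    rw [hsol x₀ hx₀ a, htproj]
    ring
  have hnonneg : 0 ≤ ∑ i, ∑ j, ginv F x₀ i j * pd i (pd j (Sfun F W)) x₀ :=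
    (himm x₀ hx₀).inv.posSemidef.sum_mul_nonneg (hloc.hessian_nonneg hS)
  rw [← sum_Hvec_mul_of_critical hFa (himm x₀ hx₀) W hcrit, hneg] at hnonneg
  linarith
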